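/- The Fischer Servi formulas FS◦(p,q) = (◦p → ◦q) → ◦(p → q) and FS◇(p,q) = (◇p → □q) → □(p → q) are not valid over the class of dynamic posets. In particular, in the dynamic poset model with W = {w, v, u}, partial order generated by v ≼ u, S(w) = v, S(v) = v, S(u) = u, ⟦p⟧ = {u} and ⟦q⟧ = ∅, the point w satisfies neither FS◦(p,q) nor FS◇(p,q). -/

import Mathlib

/-- Formulas of the language `L` of intuitionistic linear temporal logic. -/
inductive Formula : Type
  | bot : Formula
  | var : ℕ → Formula
  | and : Formula → Formula → Formula
  | or : Formula → Formula → Formula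
  | impl : Formula → Formula → Formula
  | next : Formula → Formula
  | diam : Formula → Formula
  | box : Formula → Formula
deriving DecidableEq

namespace Formula

/-- `¬φ` abbreviates `φ → ⊥`. -/
def neg (φ : Formula) : Formula := impl φ bot

/-- `φ ↔ ψ` abbreviates `(φ → ψ) ∧ (ψ → φ)`. -/
def iff (φ ψ : Formula) : Formula := and (impl φ ψ) (impl ψ φ)

end Formula

/-- Derivability in `ITL⁰` extended with an additional set of axioms `Ax`.
The intuitionistic propositional tautologies are generated by a standard
complete Hilbert-style axiomatization of intuitionistic propositional logic
(closed under modus ponens). -/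
inductive ITL (Ax : Formula → Prop) : Formula → Prop
  | extra {φ} : Ax φ → ITL Ax φ
  -- (i) intuitionistic propositional axioms
  | then1 (φ ψ : Formula) : ITL Ax (.impl φ (.impl ψ φ))
  | then2 (φ ψ χ : Formula) :
      ITL Ax (.impl (.impl φ (.impl ψ χ)) (.impl (.impl φ ψ) (.impl φ χ)))
  | andE1 (φ ψ : Formula) : ITL Ax (.impl (.and φ ψ) φ)
  | andE2 (φ ψ : Formula) : ITL Ax (.impl (.and φ ψ) ψ)
  | andI (φ ψ : Formula) : ITL Ax (.impl φ (.impl ψ (.and φ ψ)))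
  | orI1 (φ ψ : Formula) : ITL Ax (.impl φ (.or φ ψ))
  | orI2 (φ ψ : Formula) : ITL Ax (.impl ψ (.or φ ψ))
  | orE (φ ψ χ : Formula) :
      ITL Ax (.impl (.impl φ χ) (.impl (.impl ψ χ) (.impl (.or φ ψ) χ)))
  | botE (φ : Formula) : ITL Ax (.impl .bot φ)
  -- (ii)–(x) temporal axioms
  | nextBot : ITL Ax (.neg (.next .bot))
  | nextAnd (φ ψ : Formula) :
      ITL Ax (.iff (.next (.and φ ψ)) (.and (.next φ) (.next ψ)))
  | nextOr (φ ψ : Formula) :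
      ITL Ax (.iff (.next (.or φ ψ)) (.or (.next φ) (.next ψ)))
  | nextK (φ ψ : Formula) :
      ITL Ax (.impl (.next (.impl φ ψ)) (.impl (.next φ) (.next ψ)))
  | boxK (φ ψ : Formula) :
      ITL Ax (.impl (.box (.impl φ ψ)) (.impl (.box φ) (.box ψ)))
  | diamK (φ ψ : Formula) :
      ITL Ax (.impl (.box (.impl φ ψ)) (.impl (.diam φ) (.diam ψ)))
  | diamOr (φ ψ : Formula) :
      ITL Ax (.impl (.diam (.or φ ψ)) (.or (.diam φ) (.diam ψ)))
  | boxFix (φ : Formula) : ITL Ax (.impl (.box φ) (.and φ (.next (.box φ))))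
  | diamFix (φ : Formula) : ITL Ax (.impl (.or φ (.next (.diam φ))) (.diam φ))
  -- rules (xi)–(xiv)
  | ind1 {φ : Formula} : ITL Ax (.impl φ (.next φ)) → ITL Ax (.impl φ (.box φ))
  | ind2 {φ : Formula} : ITL Ax (.impl (.next φ) φ) → ITL Ax (.impl (.diam φ) φ)
  | mp {φ ψ : Formula} : ITL Ax (.impl φ ψ) → ITL Ax φ → ITL Ax ψ
  | nec {φ : Formula} : ITL Ax φ → ITL Ax (.next φ)

/-- The Fischer Servi axiom schemes FS◦ and FS◇. -/
def FSAx : Formula → Prop := fun χ => ∃ φ ψ : Formula,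
  χ = .impl (.impl (.next φ) (.next ψ)) (.next (.impl φ ψ)) ∨
  χ = .impl (.impl (.diam φ) (.box ψ)) (.box (.impl φ ψ))

/-- The constant domain axiom scheme CD. -/
def CDAx : Formula → Prop := fun χ => ∃ φ ψ : Formula,
  χ = .impl (.box (.or φ ψ)) (.or (.box φ) (.diam ψ))

/-- The logic ITL⁰. -/
def ITL0 : Formula → Prop := ITL (fun _ => False)

/-- The logic ITL^FS = ITL⁰ + FS◦ + FS◇. -/
def ITLFS : Formula → Prop := ITL FSAx

/-- The logic ITL^CD = ITL⁰ + CD. -/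
def ITLCD : Formula → Prop := ITL CDAx

/-- The logic ITL¹ = ITL^FS + ITL^CD. -/
def ITL1 : Formula → Prop := ITL (fun χ => FSAx χ ∨ CDAx χ)

/-- A valuation on a dynamical topological system `(X, T, S)`: a map from
formulas to open sets satisfying the semantic clauses. -/
structure DTValuation (X : Type) (T : TopologicalSpace X) (S : X → X) where
  val : Formula → Set X
  isOpen_val : ∀ φ, @IsOpen X T (val φ)
  val_bot : val .bot = ∅
  val_and : ∀ φ ψ, val (.and φ ψ) = val φ ∩ val ψ
  val_or : ∀ φ ψ, val (.or φ ψ) = val φ ∪ val ψ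
  val_impl : ∀ φ ψ, val (.impl φ ψ) = @interior X T ((val φ)ᶜ ∪ val ψ)
  val_next : ∀ φ, val (.next φ) = S ⁻¹' val φ
  val_diam : ∀ φ, val (.diam φ) = ⋃ n : ℕ, (S^[n]) ⁻¹' val φ
  val_box : ∀ φ, val (.box φ) =
    ⋃₀ {U : Set X | @IsOpen X T U ∧ S '' U ⊆ U ∧ U ⊆ val φ}

/-- The up-set topology of a preorder: the open sets are the upward closed sets. -/
def upsetTopology (X : Type) [Preorder X] : TopologicalSpace X where
  IsOpen U := IsUpperSet U
  isOpen_univ := isUpperSet_univ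
  isOpen_inter := fun _ _ hU hV => hU.inter hV
  isOpen_sUnion := fun _ hs => isUpperSet_sUnion hs

/-- The propositional variables `p` and `q`. -/
def pVar : Formula := .var 0
def qVar : Formula := .var 1

/-- The Fischer Servi formula FS◦(p,q) = (◦p → ◦q) → ◦(p → q). -/
def FSnextpq : Formula :=
  .impl (.impl (.next pVar) (.next qVar)) (.next (.impl pVar qVar))

/-- The Fischer Servi formula FS◇(p,q) = (◇p → □q) → □(p → q). -/
def FSdiampq : Formula :=
  .impl (.impl (.diam pVar) (.box qVar)) (.box (.impl pVar qVar))

/-- The three-point poset `{w, v, u}` with `v ≼ u`. -/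
inductive W3 : Type
  | w : W3
  | v : W3
  | u : W3
deriving DecidableEq

/-- The partial order on `W3` generated by `v ≼ u`. -/
instance : PartialOrder W3 where
  le a b := a = b ∨ (a = W3.v ∧ b = W3.u)
  le_refl a := Or.inl rfl
  le_trans a b c hab hbc := by cases a <;> cases b <;> cases c <;> simp_all
  le_antisymm a b hab hba := by cases a <;> cases b <;> simp_all

/-- The transition function: `S(w) = v`, `S(v) = v`, `S(u) = u`. -/
def S3 : W3 → W3
  | W3.w => W3.v
  | W3.v => W3.v
  | W3.u => W3.u

theorem mem_interior_upsetTopology {X : Type} [Preorder X] {A : Set X} {x : X} :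
    x ∈ @interior X (upsetTopology X) A ↔ ∀ y, x ≤ y → y ∈ A := by
  let := upsetTopology X
  rw [mem_interior]
  constructor
  · rintro ⟨U, hUA, hU, hx⟩ y hxy
    exact hUA ((show IsUpperSet U from hU) hxy hx)
  · intro h
    exact ⟨Set.Ici x, fun y hy => h y hy, isUpperSet_Ici x, le_refl x⟩

theorem continuous_upsetTopology {X Y : Type} [Preorder X] [Preorder Y] {f : X → Y}
    (hf : Monotone f) : @Continuous X Y (upsetTopology X) (upsetTopology Y) f :=
  @Continuous.mk X Y (upsetTopology X) (upsetTopology Y) f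
    fun _ hU _ _ hab ha => hU (hf hab) ha

/-- The interpretation of formulas determined by the interpretation of the variables. -/
def Formula.eval {X : Type} (T : TopologicalSpace X) (S : X → X) (P : ℕ → Set X) :
    Formula → Set X
  | .bot => ∅
  | .var n => P n
  | .and φ ψ => φ.eval T S P ∩ ψ.eval T S P
  | .or φ ψ => φ.eval T S P ∪ ψ.eval T S P
  | .impl φ ψ => @interior X T ((φ.eval T S P)ᶜ ∪ ψ.eval T S P)
  | .next φ => S ⁻¹' φ.eval T S P
  | .diam φ => ⋃ n : ℕ, (S^[n]) ⁻¹' φ.eval T S P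
  | .box φ => ⋃₀ {U : Set X | @IsOpen X T U ∧ S '' U ⊆ U ∧ U ⊆ φ.eval T S P}

theorem Formula.isOpen_eval {X : Type} (T : TopologicalSpace X) {S : X → X}
    (hS : Continuous S) {P : ℕ → Set X} (hP : ∀ n, IsOpen (P n)) (φ : Formula) :
    IsOpen (φ.eval T S P) := by
  induction φ with
  | bot => exact isOpen_empty
  | var n => exact hP n
  | and φ ψ hφ hψ => exact hφ.inter hψ
  | or φ ψ hφ hψ => exact hφ.union hψ
  | impl φ ψ _ _ => exact isOpen_interior
  | next φ hφ => exact hφ.preimage hS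
  | diam φ hφ => exact isOpen_iUnion fun n => hφ.preimage (hS.iterate n)
  | box φ _ => exact isOpen_sUnion fun U hU => hU.1

/-- The valuation extending an assignment of open sets to the variables. -/
def DTValuation.ofVars {X : Type} (T : TopologicalSpace X) {S : X → X}
    (hS : Continuous S) (P : ℕ → Set X) (hP : ∀ n, IsOpen (P n)) : DTValuation X T S where
  val := Formula.eval T S P
  isOpen_val := Formula.isOpen_eval T hS hP
  val_bot := rfl
  val_and _ _ := rfl
  val_or _ _ := rfl
  val_impl _ _ := rfl
  val_next _ := rfl
  val_diam _ := rfl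
  val_box _ := rfl

namespace W3

theorem eq_of_w_le {y : W3} (h : w ≤ y) : y = w := by
  rcases h with h | ⟨h, _⟩
  · exact h.symm
  · cases h

theorem v_le_u : v ≤ u := Or.inr ⟨rfl, rfl⟩

theorem isUpperSet_singleton_u : IsUpperSet ({u} : Set W3) := by
  rintro a b (rfl | ⟨_, rfl⟩) ha
  · exact ha
  · rfl

theorem monotone_S3 : Monotone S3 := by
  rintro a b (rfl | ⟨rfl, rfl⟩)
  · exact le_rfl
  · exact v_le_u

theorem iterate_S3_w_ne_u (n : ℕ) : S3^[n] w ≠ u := by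
  have hv : S3^[n] v = v ∧ S3^[n] w ≠ u := by
    induction n with
    | zero => simp
    | succ n ih =>
      rw [Function.iterate_succ_apply, Function.iterate_succ_apply]
      change S3^[n] v = v ∧ S3^[n] v ≠ u
      simp [ih.1]
  exact hv.2

theorem mem_val_impl_w (V : DTValuation W3 (upsetTopology W3) S3) (φ ψ : Formula) :
    w ∈ V.val (.impl φ ψ) ↔ (w ∈ V.val φ → w ∈ V.val ψ) := by
  rw [V.val_impl, mem_interior_upsetTopology]
  constructor
  · intro h hφ
    exact (h w le_rfl).resolve_left fun hn => hn hφ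
  · intro h y hy
    rw [eq_of_w_le hy]
    exact Classical.or_iff_not_imp_left.2 fun hn => h (not_not.1 hn)

variable {V : DTValuation W3 (upsetTopology W3) S3}

theorem v_notMem_val_impl (hp : V.val pVar = {u}) (hq : V.val qVar = ∅) :
    v ∉ V.val (.impl pVar qVar) := by
  rw [V.val_impl, mem_interior_upsetTopology, hp, hq]
  intro h
  simpa using h u v_le_u

theorem w_notMem_val_FSnextpq (hp : V.val pVar = {u}) (hq : V.val qVar = ∅) :
    w ∉ V.val FSnextpq := by
  rw [FSnextpq, mem_val_impl_w, mem_val_impl_w]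
  simp only [V.val_next]
  intro h
  refine v_notMem_val_impl hp hq (h fun hw => ?_)
  rw [hp] at hw
  cases hw

theorem w_notMem_val_FSdiampq (hp : V.val pVar = {u}) (hq : V.val qVar = ∅) :
    w ∉ V.val FSdiampq := by
  rw [FSdiampq, mem_val_impl_w, mem_val_impl_w]
  intro h
  have hbox : w ∈ V.val (.box (.impl pVar qVar)) := h fun hw => by
    rw [V.val_diam, hp] at hw
    obtain ⟨n, hn⟩ := Set.mem_iUnion.1 hw
    exact (iterate_S3_w_ne_u n hn).elim
  rw [V.val_box] at hbox
  obtain ⟨U, ⟨_, hSU, hU⟩, hw⟩ := hbox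
  exact v_notMem_val_impl hp hq (hU (hSU ⟨w, hw, rfl⟩))

theorem exists_valuation : ∃ V : DTValuation W3 (upsetTopology W3) S3,
    V.val pVar = {u} ∧ V.val qVar = ∅ := by
  refine ⟨DTValuation.ofVars (upsetTopology W3) (continuous_upsetTopology monotone_S3)
    (fun n => if n = 0 then {u} else ∅) fun n => ?_, rfl, rfl⟩
  split_ifs
  · exact isUpperSet_singleton_u
  · exact isUpperSet_empty

end W3

/-- Proposition 4: the Fischer Servi formulas are not valid over the class of
dynamic posets; in particular they fail at the point `w` of the dynamic poset
model on `W3` with `⟦p⟧ = {u}` and `⟦q⟧ = ∅`. -/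
theorem fs_not_valid_on_posets :
    (¬ ∀ (X : Type) [PartialOrder X] (S : X → X),
        @Continuous X X (upsetTopology X) (upsetTopology X) S →
        ∀ V : DTValuation X (upsetTopology X) S, V.val FSnextpq = Set.univ) ∧
    (¬ ∀ (X : Type) [PartialOrder X] (S : X → X),
        @Continuous X X (upsetTopology X) (upsetTopology X) S →
        ∀ V : DTValuation X (upsetTopology X) S, V.val FSdiampq = Set.univ) ∧
    (∀ V : DTValuation W3 (upsetTopology W3) S3,
      V.val pVar = {W3.u} → V.val qVar = ∅ →
      W3.w ∉ V.val FSnextpq ∧ W3.w ∉ V.val FSdiampq) := by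
  obtain ⟨V, hp, hq⟩ := W3.exists_valuation
  have hS := continuous_upsetTopology W3.monotone_S3
  refine ⟨fun h => W3.w_notMem_val_FSnextpq hp hq ?_,
    fun h => W3.w_notMem_val_FSdiampq hp hq ?_,
    fun V hp hq => ⟨W3.w_notMem_val_FSnextpq hp hq, W3.w_notMem_val_FSdiampq hp hq⟩⟩
  · exact h W3 S3 hS V ▸ Set.mem_univ _
  · exact h W3 S3 hS V ▸ Set.mem_univ _
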